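/- Let x ∈ 𝒟 satisfy E_f(x) < 1/(a + b), where a = (n−1)^{1/q} and b = 2^{1/q}. Then x lies in the domain of the Ehrlich iteration function Φ, the vector x̂ = Φ(x) has pairwise distinct components, and for each i the Weierstrass correction at x̂ satisfies the exact identity W_i(x̂) = (x̂_i − x_i)·(σ̂_i(x) − σ_i(x))·∏_{j≠i} (x̂_i − x_j)/(x̂_i − x̂_j), where σ̂_i(x) = Σ_{j≠i} W_j(x)/(x̂_i − x_j). (Lemma 3.2) -/

import Mathlib

open Finset Polynomial Filter

noncomputable section

/-- The Weierstrass correction `W_i(x) = f(x_i)/(C₀ ∏_{j≠i}(x_i − x_j))`. -/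
def Wc {n : ℕ} {K : Type*} [NormedField K] (f : Polynomial K) (x : Fin n → K) (i : Fin n) : K :=
  eval (x i) f / (f.leadingCoeff * ∏ j ∈ univ.erase i, (x i - x j))

/-- `dmin x i = min_{j ≠ i} ‖x i - x j‖`. -/
def dmin {n : ℕ} {K : Type*} [NormedField K] (x : Fin n → K) (i : Fin n) : ℝ :=
  if h : (univ.erase i).Nonempty then (univ.erase i).inf' h fun j => ‖x i - x j‖ else 0

/-- `E_f(x)` : the ℓ^p norm of the vector `(‖W_i(x)‖ / d_i(x))_i`. -/
def Ef {n : ℕ} {K : Type*} [NormedField K] (p : ENNReal) (f : Polynomial K)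
    (x : Fin n → K) : ℝ :=
  ‖(WithLp.equiv p (Fin n → ℝ)).symm (fun i => ‖Wc f x i‖ / dmin x i)‖

/-- `σ_i(x) = Σ_{j≠i} W_j(x)/(x_i − x_j)`. -/
def sigmaf {n : ℕ} {K : Type*} [NormedField K] (f : Polynomial K) (x : Fin n → K)
    (i : Fin n) : K :=
  ∑ j ∈ univ.erase i, Wc f x j / (x i - x j)

/-- The Ehrlich iteration function. -/
def PhiE {n : ℕ} {K : Type*} [NormedField K] (f : Polynomial K) (x : Fin n → K) : Fin n → K :=
  fun i => x i - Wc f x i / (1 + sigmaf f x i)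

/-- The Prešić–Tanabe iteration function. -/
def TnbE {n : ℕ} {K : Type*} [NormedField K] (f : Polynomial K) (x : Fin n → K) : Fin n → K :=
  fun i => x i - Wc f x i * (1 - sigmaf f x i)

/-- `ξ` is a root vector of `f`, i.e. `f(z) = C₀ ∏ (z − ξᵢ)`. -/
def IsRootVector {n : ℕ} {K : Type*} [NormedField K] (f : Polynomial K) (ξ : Fin n → K) : Prop :=
  f = C f.leadingCoeff * ∏ i, (X - C (ξ i))

/-- `E_f(x)` in the case `p = ∞`: the max of `‖W_i(x)‖ / d_i(x)`. -/
def Einf {n : ℕ} {K : Type*} [NormedField K] (f : Polynomial K) (x : Fin n → K) : ℝ :=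
  if h : (univ : Finset (Fin n)).Nonempty then univ.sup' h fun i => ‖Wc f x i‖ / dmin x i else 0

theorem sum_le_card_rpow_mul_norm_toLp {n : ℕ} {p q : ENNReal} (hp : 1 ≤ p)
    (hpq : p⁻¹ + q⁻¹ = 1) (w : Fin n → ℝ) (hw : ∀ i, 0 ≤ w i) {s : Finset (Fin n)} :
    ∑ i ∈ s, w i ≤
      (s.card : ℝ) ^ (ENNReal.toReal q⁻¹) * ‖(WithLp.equiv p (Fin n → ℝ)).symm w‖ := by
  have := Fact.mk hp
  rcases eq_or_ne p ⊤ with rfl | hpt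
  · have hq : q⁻¹ = 1 := by simpa using hpq
    rw [hq, ENNReal.toReal_one, Real.rpow_one, ← nsmul_eq_mul]
    refine Finset.sum_le_card_nsmul _ _ _ fun i _ => ?_
    exact (le_abs_self _).trans
      (PiLp.norm_apply_le ((WithLp.equiv ⊤ (Fin n → ℝ)).symm w) i)
  · have hp0 : p ≠ 0 := (zero_lt_one.trans_le hp).ne'
    have hr1 : 1 ≤ p.toReal := by
      simpa using (ENNReal.toReal_le_toReal ENNReal.one_ne_top hpt).2 hp
    have hr0 : 0 < p.toReal := zero_lt_one.trans_le hr1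
    have hqt : q⁻¹ ≠ ⊤ := fun h => by simp [h] at hpq
    have hq : ENNReal.toReal q⁻¹ = (p.toReal - 1) / p.toReal := by
      have h := congrArg ENNReal.toReal hpq
      rw [ENNReal.toReal_add (ENNReal.inv_ne_top.2 hp0) hqt, ENNReal.toReal_inv,
        ENNReal.toReal_one] at h
      rw [eq_sub_of_add_eq' h]
      field_simp
    rw [PiLp.norm_eq_sum hr0, hq]
    have hsum : ∑ i ∈ s, w i ^ p.toReal ≤ ∑ i, w i ^ p.toReal :=
      Finset.sum_le_univ_sum_of_nonneg fun i => Real.rpow_nonneg (hw i) _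
    have hpow := Real.rpow_sum_le_const_mul_sum_rpow_of_nonneg s hr1 fun i _ => hw i
    have hnn : 0 ≤ ∑ i, w i ^ p.toReal :=
      Finset.sum_nonneg fun i _ => Real.rpow_nonneg (hw i) _
    calc ∑ i ∈ s, w i = ((∑ i ∈ s, w i) ^ p.toReal) ^ (1 / p.toReal) := by
          rw [one_div, Real.rpow_rpow_inv (Finset.sum_nonneg fun i _ => hw i) hr0.ne']
      _ ≤ ((s.card : ℝ) ^ (p.toReal - 1) * ∑ i, w i ^ p.toReal) ^ (1 / p.toReal) := by
          refine Real.rpow_le_rpow (Real.rpow_nonneg (Finset.sum_nonneg fun i _ => hw i) _)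
            (hpow.trans ?_) (by positivity)
          gcongr
      _ = _ := by
          rw [Real.mul_rpow (by positivity) hnn, ← Real.rpow_mul (by positivity),
            mul_one_div]
          simp [abs_of_nonneg (hw _)]

theorem dmin_le {n : ℕ} {K : Type*} [NormedField K] (x : Fin n → K) {i j : Fin n}
    (hij : j ≠ i) : dmin x i ≤ ‖x i - x j‖ := by
  have hj : j ∈ univ.erase i := by simp [hij]
  rw [dmin, dif_pos ⟨j, hj⟩]
  exact Finset.inf'_le _ hj

theorem dmin_pos {n : ℕ} {K : Type*} [NormedField K] (hn : 2 ≤ n) {x : Fin n → K}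
    (hx : Function.Injective x) (i : Fin n) : 0 < dmin x i := by
  have hne : (univ.erase i).Nonempty := by
    rw [← Finset.card_pos, Finset.card_erase_of_mem (mem_univ i), Finset.card_univ,
      Fintype.card_fin]
    omega
  rw [dmin, dif_pos hne, Finset.lt_inf'_iff]
  intro j hj
  exact norm_pos_iff.2 (sub_ne_zero.2 (hx.ne (Finset.ne_of_mem_erase hj).symm))

/-- Lagrange's formula for a polynomial of degree `n` in terms of its Weierstrass corrections. -/
theorem eq_leadingCoeff_mul_nodal_add_sum_Wc {n : ℕ} {K : Type*} [NormedField K]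
    (f : Polynomial K) (hdeg : f.degree = (n : ℕ)) {x : Fin n → K}
    (hx : Function.Injective x) :
    f = C f.leadingCoeff * (Lagrange.nodal univ x +
      ∑ j, C (Wc f x j) * Lagrange.nodal (univ.erase j) x) := by
  have hf0 : f ≠ 0 := fun h => by simp [h] at hdeg
  have hlc : f.leadingCoeff ≠ 0 := leadingCoeff_ne_zero.2 hf0
  have hsub : (f - C f.leadingCoeff * Lagrange.nodal univ x).degree < (n : ℕ) := by
    rw [← hdeg]
    refine degree_sub_lt_left ?_ hf0 ?_
    · rw [degree_C_mul hlc, Lagrange.degree_nodal, hdeg]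
      simp
    · rw [leadingCoeff_mul, leadingCoeff_C, (Lagrange.nodal_monic).leadingCoeff, mul_one]
  have hsum : (C f.leadingCoeff *
      ∑ j, C (Wc f x j) * Lagrange.nodal (univ.erase j) x).degree < (n : ℕ) := by
    rw [degree_C_mul hlc]
    refine (degree_sum_le _ _).trans_lt ((Finset.sup_lt_iff (WithBot.bot_lt_coe n)).2 ?_)
    intro j _
    have hn : 0 < n := j.pos
    rw [C_mul']
    refine (degree_smul_le _ _).trans_lt ?_
    rw [Lagrange.degree_nodal, Finset.card_erase_of_mem (mem_univ j), Finset.card_univ,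
      Fintype.card_fin]
    exact WithBot.coe_lt_coe.2 (Nat.sub_lt hn one_pos)
  refine Polynomial.eq_of_degree_sub_lt_of_eval_index_eq univ (v := x) hx.injOn ?_ ?_
  · rw [mul_add, ← sub_sub, Finset.card_univ, Fintype.card_fin]
    exact (degree_sub_le _ _).trans_lt (max_lt hsub hsum)
  · intro i _
    have hprod : ∏ j ∈ univ.erase i, (x i - x j) ≠ 0 :=
      Finset.prod_ne_zero_iff.2 fun j hj =>
        sub_ne_zero.2 (hx.ne (Finset.ne_of_mem_erase hj).symm)
    rw [eval_mul, eval_C, eval_add, Lagrange.eval_nodal_at_node (mem_univ i), zero_add,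
      eval_finsetSum, Finset.sum_eq_single i]
    · rw [eval_mul, eval_C, Lagrange.eval_nodal, Wc]
      field_simp
    · intro j _ hji
      rw [eval_mul, Lagrange.eval_nodal_at_node (by simp [hji.symm]), mul_zero]
    · simp

theorem eval_eq_leadingCoeff_mul_prod_erase {n : ℕ} {K : Type*} [NormedField K]
    (f : Polynomial K) (hdeg : f.degree = (n : ℕ)) {x : Fin n → K}
    (hx : Function.Injective x) (i : Fin n) {z : K} (hz : ∀ j, j ≠ i → z ≠ x j) :
    eval z f = f.leadingCoeff * ((∏ j ∈ univ.erase i, (z - x j)) *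
      (z - x i + Wc f x i + (z - x i) * ∑ j ∈ univ.erase i, Wc f x j / (z - x j))) := by
  conv_lhs => rw [eq_leadingCoeff_mul_nodal_add_sum_Wc f hdeg hx]
  rw [eval_mul, eval_C, eval_add, eval_finsetSum, Lagrange.eval_nodal,
    ← Finset.mul_prod_erase univ _ (mem_univ i), ← Finset.add_sum_erase univ _ (mem_univ i),
    eval_mul, eval_C, Lagrange.eval_nodal]
  have hterm : ∀ j ∈ univ.erase i, eval z (C (Wc f x j) * Lagrange.nodal (univ.erase j) x) =
      (∏ k ∈ univ.erase i, (z - x k)) * ((z - x i) * (Wc f x j / (z - x j))) := by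
    intro j hj
    have hji : j ≠ i := Finset.ne_of_mem_erase hj
    have hzj : z - x j ≠ 0 := sub_ne_zero.2 (hz j hji)
    rw [eval_mul, eval_C, Lagrange.eval_nodal,
      ← Finset.mul_prod_erase (univ.erase j) _ (show i ∈ univ.erase j by simp [hji.symm]),
      ← Finset.mul_prod_erase (univ.erase i) _ hj, Finset.erase_right_comm]
    field_simp
  rw [Finset.sum_congr rfl hterm, ← Finset.mul_sum, ← Finset.mul_sum]
  ring

/-- Proinov, Lemma 3.2. -/
theorem stmt_10 {n : ℕ} {K : Type*} [NormedField K] [CompleteSpace K] (hn : 2 ≤ n)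
    (f : Polynomial K) (hdeg : f.degree = (n : ℕ))
    (p q : ENNReal) (hp : 1 ≤ p) (hpq : p⁻¹ + q⁻¹ = 1)
    (a b : ℝ) (ha : a = ((n : ℝ) - 1) ^ (ENNReal.toReal q⁻¹))
    (hb : b = (2 : ℝ) ^ (ENNReal.toReal q⁻¹))
    (x : Fin n → K) (hx : Function.Injective x)
    (hE : Ef p f x < 1 / (a + b)) :
    (∀ i : Fin n, (1 : K) + sigmaf f x i ≠ 0) ∧
    Function.Injective (PhiE f x) ∧
    ∀ i : Fin n,
      Wc f (PhiE f x) i =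
        (PhiE f x i - x i) *
          ((∑ j ∈ univ.erase i, Wc f x j / (PhiE f x i - x j)) - sigmaf f x i) *
          ∏ j ∈ univ.erase i, (PhiE f x i - x j) / (PhiE f x i - PhiE f x j) := by
  have hw : ∀ i, 0 ≤ ‖Wc f x i‖ / dmin x i := fun i =>
    div_nonneg (norm_nonneg _) (dmin_pos hn hx i).le
  have hn1 : (0 : ℝ) < (n : ℝ) - 1 := by
    have : (2 : ℝ) ≤ n := by exact_mod_cast hn
    linarith
  have ha0 : 0 < a := ha ▸ Real.rpow_pos_of_pos hn1 _
  have hb0 : 0 < b := hb ▸ Real.rpow_pos_of_pos two_pos _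
  rw [lt_div_iff₀ (by positivity)] at hE
  have hE0 : 0 ≤ Ef p f x := by
    have := Fact.mk hp
    exact norm_nonneg _
  have hsumE : ∀ i, ∑ j ∈ univ.erase i, ‖Wc f x j‖ / dmin x j ≤ a * Ef p f x := by
    intro i
    have h := sum_le_card_rpow_mul_norm_toLp hp hpq _ hw (s := univ.erase i)
    rwa [Finset.card_erase_of_mem (mem_univ i), Finset.card_univ, Fintype.card_fin,
      Nat.cast_sub (by omega), Nat.cast_one, ← ha] at h
  have hpairE : ∀ i j, i ≠ j →
      ‖Wc f x i‖ / dmin x i + ‖Wc f x j‖ / dmin x j ≤ b * Ef p f x := by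
    intro i j hij
    have h := sum_le_card_rpow_mul_norm_toLp hp hpq _ hw (s := {i, j})
    rwa [Finset.sum_pair hij, Finset.card_pair hij, Nat.cast_ofNat, ← hb] at h
  have hsig : ∀ i, ‖sigmaf f x i‖ ≤ a * Ef p f x := by
    intro i
    refine (norm_sum_le _ _).trans ((Finset.sum_le_sum fun j hj => ?_).trans (hsumE i))
    rw [norm_div, norm_sub_rev]
    exact div_le_div_of_nonneg_left (norm_nonneg _) (dmin_pos hn hx j)
      (dmin_le x (Finset.ne_of_mem_erase hj).symm)
  set δ := 1 - a * Ef p f x with hδ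
  have hbδ : b * Ef p f x < δ := by linarith
  have hδ0 : 0 < δ := (by positivity : 0 ≤ b * Ef p f x).trans_lt hbδ
  have hden : ∀ i, δ ≤ ‖1 + sigmaf f x i‖ := by
    intro i
    have h := norm_sub_le_norm_add (1 : K) (sigmaf f x i)
    rw [norm_one] at h
    linarith [hsig i]
  have hne : ∀ i, (1 : K) + sigmaf f x i ≠ 0 := fun i =>
    norm_pos_iff.1 (hδ0.trans_le (hden i))
  have hstep : ∀ i j, j ≠ i →
      ‖x i - PhiE f x i‖ * δ ≤ ‖Wc f x i‖ / dmin x i * ‖x i - x j‖ := by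
    intro i j hji
    have h : (x i - PhiE f x i) * (1 + sigmaf f x i) = Wc f x i := by
      rw [PhiE, sub_sub_cancel, div_mul_cancel₀ _ (hne i)]
    calc ‖x i - PhiE f x i‖ * δ ≤ ‖x i - PhiE f x i‖ * ‖1 + sigmaf f x i‖ := by
          gcongr
          exact hden i
      _ = ‖Wc f x i‖ / dmin x i * dmin x i := by
          rw [← norm_mul, h, div_mul_cancel₀ _ (dmin_pos hn hx i).ne']
      _ ≤ _ := mul_le_mul_of_nonneg_left (dmin_le x hji) (hw i)
  have hdist : ∀ i j, j ≠ i → 0 < ‖x i - x j‖ := fun i j hji =>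
    norm_pos_iff.2 (sub_ne_zero.2 (hx.ne hji.symm))
  have hinj : Function.Injective (PhiE f x) := by
    intro i j hij
    by_contra hne_ij
    have h1 := hstep i j (Ne.symm hne_ij)
    have h2 := hstep j i hne_ij
    rw [norm_sub_rev (x j) (x i)] at h2
    have h3 : ‖x i - x j‖ ≤ ‖x i - PhiE f x i‖ + ‖x j - PhiE f x j‖ := by
      rw [norm_sub_rev (x j), ← hij]
      exact norm_sub_le_norm_sub_add_norm_sub _ _ _
    have h4 := mul_le_mul_of_nonneg_right h3 hδ0.le
    have h5 := mul_lt_mul_of_pos_right ((hpairE i j hne_ij).trans_lt hbδ)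
      (hdist i j (Ne.symm hne_ij))
    linarith
  have hPhi_ne : ∀ i j, j ≠ i → PhiE f x i ≠ x j := by
    intro i j hji h
    have h1 := hstep i j hji
    rw [h] at h1
    have h2 := le_of_mul_le_mul_left (h1.trans_eq (mul_comm _ _)) (hdist i j hji)
    linarith [hpairE i j hji.symm, hw j]
  refine ⟨hne, hinj, fun i => ?_⟩
  have hlc : f.leadingCoeff ≠ 0 := by
    rw [leadingCoeff_ne_zero]
    rintro rfl
    simp at hdeg
  have hW : Wc f x i = (x i - PhiE f x i) * (1 + sigmaf f x i) := by
    rw [PhiE, sub_sub_cancel, div_mul_cancel₀ _ (hne i)]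
  conv_lhs => rw [Wc, eval_eq_leadingCoeff_mul_prod_erase f hdeg hx i (hPhi_ne i), hW]
  rw [mul_div_mul_left _ _ hlc, Finset.prod_div_distrib]
  ring
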